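/- Let θ ∈ ℝ and let G be a finite simple graph. Let D be the set of θ-essential vertices of G, and let A = ∂D be the set of vertices not in D that have a neighbor in D. Then for every nonempty subset X of A, the number of connected components of the induced subgraph G[D] that contain a vertex adjacent in G to some vertex of X is at least |X| + 1. -/

import Mathlib

open Polynomial

/-- The matching polynomial of a finite simple graph `G`:
`μ(G,z) = ∑_k (-1)^k p(k,G) z^(n-2k)`, written as a sum over all matchings
(finsets of pairwise disjoint edges). -/
noncomputable def matchingPolynomial {V : Type*} [Finite V] (G : SimpleGraph V) :
    Polynomial ℝ := by
  classical
  have : Fintype V := Fintype.ofFinite V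
  exact ∑ M ∈ Finset.univ.filter
      (fun M : Finset (Sym2 V) =>
        (∀ e ∈ M, e ∈ G.edgeSet) ∧ ∀ e ∈ M, ∀ f ∈ M, e ≠ f → ∀ v, v ∈ e → v ∉ f),
    (-1 : Polynomial ℝ) ^ M.card * X ^ (Nat.card V - 2 * M.card)

/-- `matchMult θ G` is the multiplicity of `θ` as a root of the matching polynomial
of `G` (equal to `0` if `θ` is not a root). -/
noncomputable def matchMult {V : Type*} [Finite V] (θ : ℝ) (G : SimpleGraph V) : ℕ :=
  Polynomial.rootMultiplicity θ (matchingPolynomial G)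

/-- A vertex `u` is `θ`-essential if `mult(θ, G-u) = mult(θ, G) - 1`. -/
def IsEssential {V : Type*} [Finite V] (θ : ℝ) (G : SimpleGraph V) (u : V) : Prop :=
  matchMult θ (G.induce {v | v ≠ u}) + 1 = matchMult θ G

/-- A vertex `u` is `θ`-positive if `mult(θ, G-u) = mult(θ, G) + 1`. -/
def IsPositive {V : Type*} [Finite V] (θ : ℝ) (G : SimpleGraph V) (u : V) : Prop :=
  matchMult θ (G.induce {v | v ≠ u}) = matchMult θ G + 1

/-- A vertex `u` is `θ`-neutral if `mult(θ, G-u) = mult(θ, G)`. -/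
def IsNeutral {V : Type*} [Finite V] (θ : ℝ) (G : SimpleGraph V) (u : V) : Prop :=
  matchMult θ (G.induce {v | v ≠ u}) = matchMult θ G

/-- A vertex is `θ`-special if it is not `θ`-essential but has a `θ`-essential neighbor. -/
def IsSpecial {V : Type*} [Finite V] (θ : ℝ) (G : SimpleGraph V) (u : V) : Prop :=
  ¬ IsEssential θ G u ∧ ∃ w, G.Adj u w ∧ IsEssential θ G w

/-- The outer vertex boundary `∂S`: vertices not in `S` with a neighbor in `S`. -/
def vertexBoundary {V : Type*} (G : SimpleGraph V) (S : Set V) : Set V :=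
  {v | v ∉ S ∧ ∃ w ∈ S, G.Adj v w}


/-- A family of polynomials indexed by finite vertex sets that obeys the
vertex recursion of matching polynomials. -/
structure MRec {V : Type*} [DecidableEq V] (G : SimpleGraph V) [DecidableRel G.Adj]
    (P : Finset V → ℝ[X]) : Prop where
  emp : P ∅ = 1
  step : ∀ (S : Finset V) (u : V), u ∈ S →
    P S = X * P (S.erase u) - ∑ y ∈ (S.erase u).filter (fun y => G.Adj u y), P ((S.erase u).erase y)

namespace MRec

variable {V : Type*} [DecidableEq V] {G : SimpleGraph V} [DecidableRel G.Adj]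
  {P : Finset V → ℝ[X]}

theorem wronskian (h : MRec G P) (x : ℝ) : ∀ (n : ℕ) (S : Finset V), S.card = n → ∀ u ∈ S,
    (eval x (P (S.erase u))) ^ 2 ≤
      eval x (derivative (P S)) * eval x (P (S.erase u)) -
        eval x (P S) * eval x (derivative (P (S.erase u))) := by
  intro n
  induction n with
  | zero => intro S hS u hu; simp_all
  | succ n ih =>
    intro S hS u hu
    have hc : (S.erase u).card = n := by rw [Finset.card_erase_of_mem hu]; omega
    rw [h.step S u hu]
    have key : ∀ y ∈ (S.erase u).filter (fun y => G.Adj u y),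
        0 ≤ eval x (derivative (P (S.erase u))) * eval x (P ((S.erase u).erase y)) -
        eval x (P (S.erase u)) * eval x (derivative (P ((S.erase u).erase y))) := by
      intro y hy
      exact le_trans (sq_nonneg _) (ih _ hc y (Finset.mem_filter.1 hy).1)
    have := Finset.sum_nonneg key
    rw [Finset.sum_sub_distrib, ← Finset.mul_sum, ← Finset.mul_sum] at this
    simp only [derivative_sub, derivative_mul, derivative_X, derivative_sum, eval_sub, eval_mul,
      eval_add, eval_finsetSum, eval_X, eval_one]
    nlinarith [this]

theorem christoffel (h : MRec G P) (x : ℝ) : ∀ (n : ℕ) (S : Finset V), S.card = n → ∀ u ∈ S,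
    ∀ v ∈ S, u ≠ v →
    0 ≤ eval x (P (S.erase u)) * eval x (P (S.erase v)) -
        eval x (P S) * eval x (P ((S.erase u).erase v)) := by
  intro n
  induction n with
  | zero => intro S hS u hu; simp_all
  | succ n ih =>
    intro S hS u hu v hv huv
    have hc : (S.erase u).card = n := by rw [Finset.card_erase_of_mem hu]; omega
    have hvu : v ∈ S.erase u := Finset.mem_erase.2 ⟨huv.symm, hv⟩
    have e1 := h.step S u hu
    have e2 := h.step (S.erase v) u (Finset.mem_erase.2 ⟨huv, hu⟩)
    rw [Finset.erase_right_comm] at e2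
    set F := (S.erase u).filter (fun y => G.Adj u y) with hF
    have hF2 : (((S.erase u).erase v).filter (fun y => G.Adj u y)) = F.erase v := by
      rw [hF]; ext z; simp only [Finset.mem_filter, Finset.mem_erase]; tauto
    rw [hF2] at e2
    have key : ∀ y ∈ F.erase v,
        0 ≤ eval x (P ((S.erase u).erase y)) * eval x (P ((S.erase u).erase v)) -
        eval x (P (S.erase u)) * eval x (P (((S.erase u).erase v).erase y)) := by
      intro y hy
      have := ih _ hc y (Finset.mem_filter.1 (Finset.mem_of_mem_erase hy)).1 v hvu
        (Finset.ne_of_mem_erase hy)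
      rwa [Finset.erase_right_comm (s := S.erase u)] at this
    have := Finset.sum_nonneg key
    rw [Finset.sum_sub_distrib, ← Finset.sum_mul, ← Finset.mul_sum] at this
    have hsum : ∃ c : ℝ, 0 ≤ c * eval x (P ((S.erase u).erase v)) ∧
        ∑ y ∈ F, eval x (P ((S.erase u).erase y)) =
        ∑ y ∈ F.erase v, eval x (P ((S.erase u).erase y)) + c := by
      by_cases hvF : v ∈ F
      · exact ⟨eval x (P ((S.erase u).erase v)), mul_self_nonneg _,
          (Finset.sum_erase_add _ _ hvF).symm⟩
      · exact ⟨0, by simp, by rw [Finset.erase_eq_of_notMem hvF]; simp⟩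
    obtain ⟨c, hc0, hc1⟩ := hsum
    rw [e1, e2]
    simp only [eval_sub, eval_mul, eval_finsetSum, eval_X]
    rw [hc1]
    nlinarith [this]

theorem deriv_eq (h : MRec G P) : ∀ (n : ℕ) (S : Finset V), S.card = n →
    derivative (P S) = ∑ u ∈ S, P (S.erase u) := by
  intro n
  induction n using Nat.strong_induction_on with
  | _ n ih =>
    intro S hS
    rcases S.eq_empty_or_nonempty with rfl | ⟨u, hu⟩
    · simp [h.emp]
    · have hc : (S.erase u).card + 1 = n := by rw [Finset.card_erase_add_one hu]; omega
      have e1 := h.step S u hu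
      rw [← Finset.add_sum_erase _ _ hu]
      have e2 : ∀ v ∈ S.erase u, P (S.erase v) = X * P ((S.erase u).erase v) -
          ∑ y ∈ (S.erase u).filter (fun y => G.Adj u y),
            if y = v then 0 else P (((S.erase u).erase y).erase v) := by
        intro v hv
        rw [h.step (S.erase v) u (Finset.mem_erase.2 ⟨(Finset.ne_of_mem_erase hv).symm, hu⟩)]
        rw [Finset.erase_right_comm]
        congr 1
        rw [show (((S.erase u).erase v).filter (fun y => G.Adj u y)) =
          ((S.erase u).filter (fun y => G.Adj u y)).erase v by
            ext z; simp only [Finset.mem_filter, Finset.mem_erase]; tauto, ← Finset.filter_ne', Finset.sum_filter]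
        apply Finset.sum_congr rfl
        intro y hy
        by_cases hyv : y = v
        · simp [hyv]
        · simp [hyv, Finset.erase_right_comm]
      rw [Finset.sum_congr rfl e2, Finset.sum_sub_distrib, ← Finset.mul_sum,
        ← ih _ (by omega) _ rfl, Finset.sum_comm]
      rw [e1]
      simp only [derivative_sub, derivative_mul, derivative_X, derivative_sum, one_mul]
      rw [add_sub_assoc]
      congr 2
      apply Finset.sum_congr rfl
      intro y hy
      have hyS := (Finset.mem_filter.1 hy).1
      have hc2 : ((S.erase u).erase y).card + 1 = (S.erase u).card :=
        Finset.card_erase_add_one hyS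
      rw [ih _ (by omega) _ rfl, ← Finset.add_sum_erase _ _ hyS, if_pos rfl, zero_add]
      apply Finset.sum_congr rfl
      intro v hv
      rw [if_neg (Finset.ne_of_mem_erase hv).symm]

theorem mul_of_disjoint (h : MRec G P) (T : Finset V) : ∀ (n : ℕ) (S : Finset V), S.card = n →
    Disjoint S T → (∀ s ∈ S, ∀ t ∈ T, ¬ G.Adj s t) → P (S ∪ T) = P S * P T := by
  intro n
  induction n using Nat.strong_induction_on with
  | _ n ih =>
    intro S hS hd ha
    rcases S.eq_empty_or_nonempty with rfl | ⟨u, hu⟩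
    · simp [h.emp]
    · have hc : (S.erase u).card + 1 = n := by rw [Finset.card_erase_add_one hu]; omega
      have huT : u ∉ T := Finset.disjoint_left.1 hd hu
      have hU : (S ∪ T).erase u = S.erase u ∪ T := by
        rw [Finset.erase_union_distrib, Finset.erase_eq_of_notMem huT]
      have mono : ∀ S' ⊆ S, S'.card < n → P (S' ∪ T) = P S' * P T := fun S' hs hlt =>
        ih _ hlt S' rfl (hd.mono_left hs) (fun s hs' => ha s (hs hs'))
      rw [h.step (S ∪ T) u (Finset.mem_union_left _ hu), h.step S u hu, hU,
        mono _ (Finset.erase_subset _ _) (by omega), sub_mul, mul_assoc, Finset.sum_mul]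
      congr 1
      have hF : (S.erase u ∪ T).filter (fun y => G.Adj u y) =
          (S.erase u).filter (fun y => G.Adj u y) := by
        rw [Finset.filter_union]
        have : T.filter (fun y => G.Adj u y) = ∅ := by
          apply Finset.filter_eq_empty_iff.2
          intro t ht
          exact ha u hu t ht
        rw [this, Finset.union_empty]
      rw [hF]
      apply Finset.sum_congr rfl
      intro y hy
      have hyS := (Finset.mem_filter.1 hy).1
      have hyT : y ∉ T := Finset.disjoint_left.1 hd (Finset.mem_of_mem_erase hyS)
      rw [Finset.erase_union_distrib, Finset.erase_eq_of_notMem hyT]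
      have hc2 : ((S.erase u).erase y).card + 1 = (S.erase u).card :=
        Finset.card_erase_add_one hyS
      exact mono _ ((Finset.erase_subset _ _).trans (Finset.erase_subset _ _)) (by omega)

theorem ne_zero (h : MRec G P) : ∀ (n : ℕ) (S : Finset V), S.card = n → P S ≠ 0 := by
  intro n
  induction n with
  | zero => intro S hS; rw [Finset.card_eq_zero.1 hS, h.emp]; exact one_ne_zero
  | succ n ih =>
    intro S hS h0
    obtain ⟨u, hu⟩ := Finset.card_pos.1 (by omega : 0 < S.card)
    have hc : (S.erase u).card = n := by rw [Finset.card_erase_of_mem hu]; omega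
    apply ih _ hc
    apply Polynomial.funext
    intro x
    have := h.wronskian x _ S rfl u hu
    rw [h0] at this
    simp at this
    simpa using this

theorem nz (h : MRec G P) (S : Finset V) : P S ≠ 0 := h.ne_zero _ S rfl

end MRec
namespace MRec

set_option linter.unusedSectionVars false

variable {V : Type*} [DecidableEq V] {G : SimpleGraph V} [DecidableRel G.Adj]
  {P : Finset V → ℝ[X]}

/-- multiplicity -/
noncomputable def mm (P : Finset V → ℝ[X]) (θ : ℝ) (S : Finset V) : ℕ :=
  (P S).rootMultiplicity θ

theorem factor (h : MRec G P) (θ : ℝ) (S : Finset V) :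
    ∃ g : ℝ[X], P S = (X - C θ) ^ (mm P θ S) * g ∧ eval θ g ≠ 0 := by
  obtain ⟨g, hg, hn⟩ := exists_eq_pow_rootMultiplicity_mul_and_not_dvd (P S) (h.nz S) θ
  refine ⟨g, hg, ?_⟩
  intro h0
  exact hn (dvd_iff_isRoot.2 h0)

theorem le_mm (h : MRec G P) (θ : ℝ) (S : Finset V) (k : ℕ) :
    k ≤ mm P θ S ↔ (X - C θ) ^ k ∣ P S := le_rootMultiplicity_iff (h.nz S)

theorem mm_eq {θ : ℝ} {S : Finset V} {k : ℕ} {g : ℝ[X]} (hg : P S = (X - C θ) ^ k * g)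
    (h0 : eval θ g ≠ 0) : mm P θ S = k := by
  have hg0 : g ≠ 0 := by rintro rfl; simp at h0
  rw [mm, hg, rootMultiplicity_mul (mul_ne_zero (pow_ne_zero _ (X_sub_C_ne_zero θ)) hg0),
    rootMultiplicity_X_sub_C_pow, rootMultiplicity_eq_zero h0, add_zero]

theorem poly_ineq {p : ℝ[X]} {θ : ℝ} (hp : ∀ x, x ≠ θ → 0 ≤ eval x p) : 0 ≤ eval θ p := by
  have hc : ContinuousAt (fun x => eval x p) θ := p.continuous.continuousAt
  have ht : Filter.Tendsto (fun x => eval x p) (nhdsWithin θ {θ}ᶜ) (nhds (eval θ p)) :=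
    hc.tendsto.mono_left nhdsWithin_le_nhds
  refine ge_of_tendsto ht ?_
  filter_upwards [self_mem_nhdsWithin] with x hx
  exact hp x hx

/-- core sign estimate -/
theorem sign_core (h : MRec G P) (θ : ℝ) (S : Finset V) (u : V) (hu : u ∈ S) (g k : ℝ[X])
    (b a : ℕ) (hg : P S = (X - C θ) ^ b * g) (hk : P (S.erase u) = (X - C θ) ^ a * k)
    (hk0 : eval θ k ≠ 0) (hab : a + 1 ≤ b) : b = a + 1 ∧ 0 < eval θ g * eval θ k := by
  obtain ⟨d, rfl⟩ := Nat.exists_eq_add_of_le hab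
  have key : 0 ≤ eval θ ((X - C θ) ^ d * ((C ((d : ℝ) + 1)) * g * k +
      (X - C θ) * (derivative g * k - g * derivative k)) - k ^ 2) := by
    apply poly_ineq
    intro x hx
    have hw := h.wronskian x _ S rfl u hu
    rw [hg, hk] at hw
    have hx' : 0 < ((x - θ) ^ a) ^ 2 := by
      have : x - θ ≠ 0 := sub_ne_zero.2 hx
      positivity
    refine (mul_nonneg_iff_of_pos_left hx').1 ?_
    simp only [derivative_mul, derivative_X_sub_C_pow, eval_mul, eval_add, eval_sub, eval_pow,
      eval_X, eval_C] at hw ⊢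
    rcases a with _ | a
    · simp at hw ⊢
      ring_nf at hw ⊢
      cases d with
      | zero => simp at hw ⊢; nlinarith [hw]
      | succ d => simp at hw ⊢; ring_nf at hw ⊢; nlinarith [hw]
    · have e1 : a + 1 + 1 + d - 1 = a + 1 + d := by omega
      rw [e1, Nat.add_sub_cancel] at hw
      push_cast at hw
      ring_nf at hw ⊢
      nlinarith [hw]
  have hk2 : 0 < (eval θ k) ^ 2 := by positivity
  simp only [eval_mul, eval_add, eval_sub, eval_pow, eval_X, eval_C, sub_self, zero_mul,
    add_zero] at key
  rcases d with _ | d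
  · simp at key
    refine ⟨rfl, by linarith⟩
  · simp at key
    exact absurd key hk0

theorem le_succ (h : MRec G P) (θ : ℝ) (S : Finset V) (u : V) (hu : u ∈ S) :
    mm P θ S ≤ mm P θ (S.erase u) + 1 := by
  obtain ⟨g, hg, -⟩ := h.factor θ S
  obtain ⟨k, hk, hk0⟩ := h.factor θ (S.erase u)
  by_contra hlt
  have := (h.sign_core θ S u hu g k _ _ hg hk hk0 (by omega)).1
  omega

theorem sign (h : MRec G P) (θ : ℝ) (S : Finset V) (u : V) (hu : u ∈ S) (g : ℝ[X]) (b : ℕ)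
    (hb : mm P θ S = b + 1) (hg : P S = (X - C θ) ^ (b + 1) * g) :
    ∃ k : ℝ[X], P (S.erase u) = (X - C θ) ^ b * k ∧ 0 ≤ eval θ g * eval θ k ∧
      (mm P θ (S.erase u) = b → 0 < eval θ g * eval θ k) := by
  have h1 := h.le_succ θ S u hu
  obtain ⟨k, hk, hk0⟩ := h.factor θ (S.erase u)
  by_cases he : mm P θ (S.erase u) = b
  · rw [he] at hk
    have := (h.sign_core θ S u hu g k _ _ hg hk hk0 (by omega)).2
    exact ⟨k, hk, this.le, fun _ => this⟩
  · obtain ⟨d, hd⟩ := Nat.exists_eq_add_of_le (show b + 1 ≤ mm P θ (S.erase u) by omega)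
    refine ⟨(X - C θ) * ((X - C θ) ^ d * k), ?_, ?_, fun h' => absurd h' he⟩
    · rw [hk, hd]; ring
    · simp

theorem pos_of_nbr (h : MRec G P) (θ : ℝ) (S : Finset V) (u x : V) (hu : u ∈ S)
    (hx : x ∈ S.erase u) (hux : G.Adj u x)
    (he : mm P θ ((S.erase u).erase x) + 1 = mm P θ (S.erase u)) :
    mm P θ (S.erase u) = mm P θ S + 1 := by
  obtain ⟨g, hg, hg0⟩ := h.factor θ (S.erase u)
  set b := mm P θ ((S.erase u).erase x) with hb
  rw [← he] at hg
  have hs : ∀ y ∈ S.erase u, ∃ k : ℝ[X], P ((S.erase u).erase y) = (X - C θ) ^ b * k ∧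
      0 ≤ eval θ g * eval θ k ∧
      (mm P θ ((S.erase u).erase y) = b → 0 < eval θ g * eval θ k) := fun y hy =>
    h.sign θ (S.erase u) y hy g b he.symm hg
  choose! k hk1 hk2 hk3 using hs
  have hsum : P S = (X - C θ) ^ b * ((X - C θ) * X * g -
      ∑ y ∈ (S.erase u).filter (fun y => G.Adj u y), k y) := by
    rw [h.step S u hu, Finset.sum_congr rfl (fun y hy => hk1 y (Finset.mem_filter.1 hy).1),
      ← Finset.mul_sum, hg]
    ring
  have hpos : 0 < eval θ g * ∑ y ∈ (S.erase u).filter (fun y => G.Adj u y), eval θ (k y) := by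
    rw [Finset.mul_sum]
    exact Finset.sum_pos' (fun y hy => hk2 y (Finset.mem_filter.1 hy).1)
      ⟨x, Finset.mem_filter.2 ⟨hx, hux⟩, hk3 x hx rfl⟩
  rw [mm_eq hsum, ← he]
  simp only [eval_sub, eval_mul, eval_X, eval_C, sub_self, zero_mul, eval_finsetSum, zero_sub]
  intro h0
  rw [neg_eq_zero.1 h0] at hpos
  simp at hpos

theorem le_of_no_nbr (h : MRec G P) (θ : ℝ) (S : Finset V) (u : V) (hu : u ∈ S)
    (hn : ∀ x ∈ S.erase u, G.Adj u x → mm P θ (S.erase u) ≤ mm P θ ((S.erase u).erase x)) :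
    mm P θ (S.erase u) ≤ mm P θ S := by
  rw [h.le_mm, h.step S u hu]
  apply dvd_sub
  · exact Dvd.dvd.mul_left ((h.le_mm θ _ _).1 le_rfl) _
  · apply Finset.dvd_sum
    intro y hy
    exact (h.le_mm θ _ _).1 (hn y (Finset.mem_filter.1 hy).1 (Finset.mem_filter.1 hy).2)

theorem erase_le (h : MRec G P) (θ : ℝ) (S : Finset V) (u : V) (hu : u ∈ S) :
    mm P θ (S.erase u) ≤ mm P θ S + 1 := by
  by_cases hn : ∀ x ∈ S.erase u, G.Adj u x → mm P θ (S.erase u) ≤ mm P θ ((S.erase u).erase x)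
  · exact (h.le_of_no_nbr θ S u hu hn).trans (Nat.le_succ _)
  · push Not at hn
    obtain ⟨x, hx, hux, hlt⟩ := hn
    have := h.le_succ θ (S.erase u) x hx
    exact (h.pos_of_nbr θ S u x hu hx hux (by omega)).le

/-- If `u` is positive, it has a neighbour that is essential after deleting `u`. -/
theorem exists_nbr (h : MRec G P) (θ : ℝ) (S : Finset V) (u : V) (hu : u ∈ S)
    (hp : mm P θ S < mm P θ (S.erase u)) : ∃ x ∈ S.erase u, G.Adj u x ∧
      mm P θ ((S.erase u).erase x) + 1 = mm P θ (S.erase u) := by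
  by_contra hn
  push Not at hn
  have := h.le_of_no_nbr θ S u hu (fun x hx hux => by
    have := hn x hx hux
    have := h.le_succ θ (S.erase u) x hx
    omega)
  omega

/-- A nonnegative polynomial has even order. -/
theorem even_order {q g : ℝ[X]} {θ : ℝ} {k : ℕ} (hq : ∀ x, 0 ≤ eval x q)
    (hg : q = (X - C θ) ^ (2 * k + 1) * g) : eval θ g = 0 := by
  have h1 : 0 ≤ eval θ ((X - C θ) * g) := by
    simp
  have hx : ∀ x, 0 ≤ (x - θ) * eval x g ∨ x = θ := by
    intro x
    by_cases hx : x = θ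
    · exact Or.inr hx
    left
    have hx' : 0 < ((x - θ) ^ k) ^ 2 := by
      have : x - θ ≠ 0 := sub_ne_zero.2 hx
      positivity
    have := hq x
    rw [hg] at this
    simp only [eval_mul, eval_sub, eval_pow, eval_X, eval_C] at this
    refine (mul_nonneg_iff_of_pos_left hx').1 ?_
    calc (0 : ℝ) ≤ _ := this
      _ = _ := by ring
  have hc : ContinuousAt (fun x => eval x g) θ := g.continuous.continuousAt
  apply le_antisymm
  · have ht : Filter.Tendsto (fun x => eval x g) (nhdsWithin θ (Set.Iio θ)) (nhds (eval θ g)) :=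
      hc.tendsto.mono_left nhdsWithin_le_nhds
    refine le_of_tendsto ht ?_
    filter_upwards [self_mem_nhdsWithin] with x hx'
    have hx' : x < θ := hx'
    rcases hx x with h | h
    · nlinarith
    · linarith
  · have ht : Filter.Tendsto (fun x => eval x g) (nhdsWithin θ (Set.Ioi θ)) (nhds (eval θ g)) :=
      hc.tendsto.mono_left nhdsWithin_le_nhds
    refine ge_of_tendsto ht ?_
    filter_upwards [self_mem_nhdsWithin] with x hx'
    have hx' : θ < x := hx'
    rcases hx x with h | h
    · nlinarith
    · linarith

theorem chr (h : MRec G P) (S : Finset V) (u v : V) (hu : u ∈ S) (hv : v ∈ S) (huv : u ≠ v)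
    (x : ℝ) : 0 ≤ eval x (P (S.erase u) * P (S.erase v) - P S * P ((S.erase u).erase v)) := by
  simpa using h.christoffel x _ S rfl u hu v hv huv

/-- nonessential `v`, essential `w` : `w` is essential after deleting `v`. -/
theorem ess_erase (h : MRec G P) (θ : ℝ) (S : Finset V) (v w : V) (hv : v ∈ S) (hw : w ∈ S)
    (hnv : mm P θ S ≤ mm P θ (S.erase v)) (hew : mm P θ (S.erase w) + 1 = mm P θ S) :
    mm P θ ((S.erase v).erase w) + 1 = mm P θ (S.erase v) := by
  have hvw : v ≠ w := by rintro rfl; omega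
  have hw' : w ∈ S.erase v := Finset.mem_erase.2 ⟨hvw.symm, hw⟩
  have hv' : v ∈ S.erase w := Finset.mem_erase.2 ⟨hvw, hv⟩
  have h1 := h.le_succ θ _ w hw'
  have h2 := h.erase_le θ _ v hv
  have h3 := h.erase_le θ _ v hv'
  rw [Finset.erase_right_comm] at h3
  by_contra hne
  have e1 : mm P θ (S.erase v) = mm P θ S := by omega
  obtain ⟨g1, hg1, h10⟩ := h.factor θ (S.erase v)
  obtain ⟨g2, hg2, h20⟩ := h.factor θ (S.erase w)
  obtain ⟨g3, hg3⟩ := (h.le_mm θ S _).1 le_rfl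
  obtain ⟨g4, hg4⟩ := (h.le_mm θ ((S.erase v).erase w) (mm P θ S)).1 (by omega)
  have := even_order (θ := θ) (k := mm P θ (S.erase w)) (g := g1 * g2 - (X - C θ) * g3 * g4)
    (h.chr S v w hv hw hvw) (by
      rw [hg1, hg2, hg4, hg3, e1, ← hew]
      ring)
  simp at this
  tauto

/-- two nonessential vertices -/
theorem pair (h : MRec G P) (θ : ℝ) (S : Finset V) (v w : V) (hv : v ∈ S) (hw : w ∈ S)
    (hnv : mm P θ S ≤ mm P θ (S.erase v)) (hnw : mm P θ S ≤ mm P θ (S.erase w)) :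
    mm P θ S ≤ mm P θ ((S.erase v).erase w) := by
  by_cases hvw : v = w
  · subst hvw; simpa using hnv
  have hw' : w ∈ S.erase v := Finset.mem_erase.2 ⟨Ne.symm hvw, hw⟩
  have hv' : v ∈ S.erase w := Finset.mem_erase.2 ⟨hvw, hv⟩
  have h1 := h.le_succ θ _ w hw'
  by_contra hlt
  obtain ⟨b, hb⟩ := (⟨mm P θ S - 1, by omega⟩ : ∃ b, mm P θ S = b + 1)
  have hb' : mm P θ ((S.erase v).erase w) = b := by omega
  obtain ⟨g1, hg1⟩ := (h.le_mm θ (S.erase v) (b + 1)).1 (by omega)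
  obtain ⟨g2, hg2⟩ := (h.le_mm θ (S.erase w) (b + 1)).1 (by omega)
  obtain ⟨g3, hg3, h30⟩ := h.factor θ S
  obtain ⟨g4, hg4, h40⟩ := h.factor θ ((S.erase v).erase w)
  have := even_order (θ := θ) (k := b) (g := (X - C θ) * g1 * g2 - g3 * g4)
    (h.chr S v w hv hw hvw) (by
      rw [hg1, hg2, hg4, hg3, hb', hb]
      ring)
  simp at this
  tauto

theorem exists_ess (h : MRec G P) (θ : ℝ) (S : Finset V) (hp : 0 < mm P θ S) :
    ∃ u ∈ S, mm P θ (S.erase u) + 1 = mm P θ S := by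
  by_contra hn
  push Not at hn
  have hle : ∀ u ∈ S, mm P θ S ≤ mm P θ (S.erase u) := fun u hu => by
    have := hn u hu
    have := h.le_succ θ S u hu
    omega
  have hd : (X - C θ) ^ (mm P θ S) ∣ derivative (P S) := by
    rw [h.deriv_eq _ S rfl]
    exact Finset.dvd_sum (fun u hu => (h.le_mm θ _ _).1 (hle u hu))
  obtain ⟨g, hg, hg0⟩ := h.factor θ S
  obtain ⟨b, hb⟩ := (⟨mm P θ S - 1, by omega⟩ : ∃ b, mm P θ S = b + 1)
  rw [hb] at hg hd
  obtain ⟨k, hk⟩ := hd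
  rw [hg, derivative_mul, derivative_X_sub_C_pow] at hk
  have e : (X - C θ) ^ b * ((C ((b : ℝ) + 1)) * g) =
      (X - C θ) ^ b * ((X - C θ) * (k - derivative g)) := by
    have : (C ((b : ℝ) + 1)) = C (((b + 1 : ℕ)) : ℝ) := by push_cast; rfl
    rw [this]
    rw [Nat.add_sub_cancel] at hk
    linear_combination hk
  have e2 := mul_left_cancel₀ (pow_ne_zero _ (X_sub_C_ne_zero θ)) e
  have e3 := congrArg (eval θ) e2
  simp at e3
  rcases e3 with e3 | e3
  · have : (0 : ℝ) < (b : ℝ) + 1 := by positivity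
    linarith
  · exact hg0 e3

theorem mm_union (h : MRec G P) (θ : ℝ) (S T : Finset V) (hd : Disjoint S T)
    (ha : ∀ s ∈ S, ∀ t ∈ T, ¬ G.Adj s t) : mm P θ (S ∪ T) = mm P θ S + mm P θ T := by
  rw [mm, h.mul_of_disjoint T _ S rfl hd ha, rootMultiplicity_mul
    (mul_ne_zero (h.nz _) (h.nz _))]
  rfl

theorem mm_empty (h : MRec G P) (θ : ℝ) : mm P θ ∅ = 0 := by
  rw [mm, h.emp]
  exact rootMultiplicity_eq_zero (by simp)

end MRec
namespace MRec

set_option linter.unusedSectionVars false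

variable {V : Type*} [DecidableEq V] {G : SimpleGraph V} [DecidableRel G.Adj]
  {P : Finset V → ℝ[X]}

/-- transitivity statement -/
def TransAt (P : Finset V → ℝ[X]) (θ : ℝ) (S : Finset V) : Prop :=
  ∀ w ∈ S, ∀ v ∈ S, ∀ w' ∈ S, mm P θ (S.erase w) + 1 = mm P θ S →
    mm P θ (S.erase v) + 1 = mm P θ S → mm P θ (S.erase w') + 1 = mm P θ S →
    mm P θ S ≤ mm P θ ((S.erase w).erase v) + 1 →
    mm P θ S ≤ mm P θ ((S.erase v).erase w') + 1 →
    mm P θ S ≤ mm P θ ((S.erase w).erase w') + 1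

/-- triple statement -/
def TripleAt (P : Finset V → ℝ[X]) (θ : ℝ) (S : Finset V) : Prop :=
  ∀ a ∈ S, ∀ b ∈ S, ∀ c ∈ S, a ≠ b → a ≠ c → b ≠ c → mm P θ S ≤ mm P θ (S.erase a) →
    mm P θ S ≤ mm P θ (S.erase b) → mm P θ S ≤ mm P θ (S.erase c) →
    mm P θ S ≤ mm P θ (((S.erase a).erase b).erase c)

theorem no_nbr_of_not_pos (h : MRec G P) (θ : ℝ) (S : Finset V) (u x : V) (hu : u ∈ S)
    (hx : x ∈ S.erase u) (hux : G.Adj u x) (hle : mm P θ (S.erase u) ≤ mm P θ S) :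
    mm P θ (S.erase u) ≤ mm P θ ((S.erase u).erase x) := by
  by_contra hlt
  have h1 := h.le_succ θ _ x hx
  have := h.pos_of_nbr θ S u x hu hx hux (by omega)
  omega

theorem trans_of_triple (h : MRec G P) (θ : ℝ) (S : Finset V)
    (hC : ∀ v ∈ S, TripleAt P θ (S.erase v)) : TransAt P θ S := by
  intro w hw v hv w' hw' ew ev ew' h1 h2
  by_cases hvw : v = w
  · rwa [hvw] at h2
  by_cases hvw' : v = w'
  · rwa [hvw'] at h1
  by_cases hww' : w = w'
  · subst hww'; simp; omega
  by_contra hlt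
  have mv_w : v ∈ S.erase w := Finset.mem_erase.2 ⟨hvw, hv⟩
  have mv_w' : v ∈ S.erase w' := Finset.mem_erase.2 ⟨hvw', hv⟩
  have mw'_w : w' ∈ S.erase w := Finset.mem_erase.2 ⟨Ne.symm hww', hw'⟩
  have mw_w' : w ∈ S.erase w' := Finset.mem_erase.2 ⟨hww', hw⟩
  have mw_v : w ∈ S.erase v := Finset.mem_erase.2 ⟨Ne.symm hvw, hw⟩
  have mw'_v : w' ∈ S.erase v := Finset.mem_erase.2 ⟨Ne.symm hvw', hw'⟩
  have mv_ww' : v ∈ (S.erase w).erase w' := Finset.mem_erase.2 ⟨hvw', mv_w⟩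
  have c1 : (S.erase w).erase v = (S.erase v).erase w := Finset.erase_right_comm
  have i1 := h.le_succ θ _ w' mw'_w
  have e1 := h.ess_erase θ (S.erase w) v w' mv_w mw'_w (by omega) (by omega)
  have p1 := h.pair θ (S.erase v) w w' mw_v mw'_v (by rw [← c1]; omega) (by omega)
  rw [c1] at e1
  have c2 : ((S.erase w).erase w').erase v = ((S.erase v).erase w).erase w' := by
    ext z; simp only [Finset.mem_erase]; tauto
  obtain ⟨y, hy, hvy, hey⟩ := h.exists_nbr θ ((S.erase w).erase w') v mv_ww'
    (by rw [c2]; omega)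
  have i2 := h.erase_le θ _ v mv_ww'
  rw [c2] at hey i2 hy
  simp only [Finset.mem_erase] at hy
  have my : y ∈ S.erase v := Finset.mem_erase.2 ⟨hy.2.2.1, hy.2.2.2⟩
  have hyn := h.no_nbr_of_not_pos θ S v y hv my hvy (by omega)
  have := hC v hv w mw_v w' mw'_v y my hww' (Ne.symm hy.2.1) (Ne.symm hy.1)
    (by rw [← c1]; omega) (by omega) hyn
  omega

theorem triple_of_trans (h : MRec G P) (θ : ℝ) (S : Finset V)
    (hT : ∀ v ∈ S, TransAt P θ (S.erase v)) : TripleAt P θ S := by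
  have single : ∀ a ∈ S, ∀ b ∈ S, ∀ c ∈ S, a ≠ b → a ≠ c → b ≠ c →
      mm P θ S ≤ mm P θ (S.erase a) →
      mm P θ S ≤ mm P θ (S.erase b) → mm P θ S ≤ mm P θ (S.erase c) →
      mm P θ (((S.erase a).erase b).erase c) < mm P θ S → mm P θ (S.erase a) = mm P θ S + 1 ∧
        mm P θ ((S.erase a).erase b) = mm P θ S := by
    intro a ha b hb c hc hab hac hbc na nb nc hlt
    have mb : b ∈ S.erase a := Finset.mem_erase.2 ⟨Ne.symm hab, hb⟩
    have mc : c ∈ S.erase a := Finset.mem_erase.2 ⟨Ne.symm hac, hc⟩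
    have mc' : c ∈ (S.erase a).erase b := Finset.mem_erase.2 ⟨Ne.symm hbc, mc⟩
    have pab := h.pair θ S a b ha hb na nb
    have pac := h.pair θ S a c ha hc na nc
    have i1 := h.erase_le θ S a ha
    have i2 := h.le_succ θ _ c mc'
    refine ⟨?_, by omega⟩
    by_contra hne
    have := h.pair θ (S.erase a) b c mb mc (by omega) (by omega)
    omega
  intro a ha b hb c hc hab hac hbc na nb nc
  by_contra hlt
  push Not at hlt
  obtain ⟨sa, sab⟩ := single a ha b hb c hc hab hac hbc na nb nc hlt
  have cb : ((S.erase b).erase a).erase c = ((S.erase a).erase b).erase c := by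
    ext z; simp only [Finset.mem_erase]; tauto
  have cc : ((S.erase c).erase a).erase b = ((S.erase a).erase b).erase c := by
    ext z; simp only [Finset.mem_erase]; tauto
  obtain ⟨sb, sba⟩ := single b hb a ha c hc hab.symm hbc hac nb na nc (by rwa [cb])
  obtain ⟨sc, sca⟩ := single c hc a ha b hb hac.symm hbc.symm hab nc na nb (by rwa [cc])
  have sac : mm P θ ((S.erase a).erase c) = mm P θ S := by
    rw [← sca, Finset.erase_right_comm]
  obtain ⟨x, hx, hax, hex⟩ := h.exists_nbr θ S a ha (by omega)
  have claim : ∀ z ∈ S, z ≠ a → mm P θ (S.erase z) = mm P θ S + 1 →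
      mm P θ ((S.erase z).erase a) = mm P θ S → x ≠ z →
      mm P θ S ≤ mm P θ (((S.erase z).erase a).erase x) := by
    intro z hz hza h1 h2 hxz
    have := h.no_nbr_of_not_pos θ (S.erase z) a x (Finset.mem_erase.2 ⟨hza.symm, ha⟩)
      (by simp only [Finset.mem_erase] at hx ⊢; tauto) hax (by omega)
    omega
  by_cases hxb : x = b
  · have := claim c hc hac.symm sc sca (by rw [hxb]; exact hbc)
    rw [hxb, cc] at this
    omega
  by_cases hxc : x = c
  · have := claim b hb hab.symm sb sba (by rw [hxc]; exact hbc.symm)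
    rw [hxc, cb] at this
    omega
  have k1 := claim b hb hab.symm sb sba hxb
  have k2 := claim c hc hac.symm sc sca hxc
  have d1 : ((S.erase b).erase a).erase x = ((S.erase a).erase b).erase x := by
    ext z; simp only [Finset.mem_erase]; tauto
  have d2 : ((S.erase c).erase a).erase x = ((S.erase a).erase x).erase c := by
    ext z; simp only [Finset.mem_erase]; tauto
  rw [d1] at k1
  rw [d2] at k2
  have := hT a ha b (Finset.mem_erase.2 ⟨hab.symm, hb⟩) x hx c
    (Finset.mem_erase.2 ⟨hac.symm, hc⟩) (by omega) (by omega) (by omega) (by omega) (by omega)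
  omega

theorem trans_triple (h : MRec G P) (θ : ℝ) : ∀ (n : ℕ) (S : Finset V), S.card = n →
    TransAt P θ S ∧ TripleAt P θ S := by
  intro n
  induction n with
  | zero =>
    intro S hS
    rw [Finset.card_eq_zero] at hS
    subst hS
    exact ⟨fun w hw => by simp at hw, fun w hw => by simp at hw⟩
  | succ n ih =>
    intro S hS
    have hc : ∀ u ∈ S, (S.erase u).card = n := fun u hu => by
      rw [Finset.card_erase_of_mem hu]; omega
    exact ⟨h.trans_of_triple θ S fun v hv => (ih _ (hc v hv)).2,
      h.triple_of_trans θ S fun v hv => (ih _ (hc v hv)).1⟩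

theorem special_pos (h : MRec G P) (θ : ℝ) (S : Finset V) (u w : V) (hu : u ∈ S) (hw : w ∈ S)
    (huw : G.Adj u w) (nu : mm P θ S ≤ mm P θ (S.erase u))
    (ew : mm P θ (S.erase w) + 1 = mm P θ S) : mm P θ (S.erase u) = mm P θ S + 1 :=
  h.pos_of_nbr θ S u w hu (Finset.mem_erase.2 ⟨huw.ne.symm, hw⟩) huw
    (h.ess_erase θ S u w hu hw nu ew)

theorem stability (h : MRec G P) (θ : ℝ) (S : Finset V) (u w : V) (hu : u ∈ S) (hw : w ∈ S)
    (huw : G.Adj u w) (nu : mm P θ S ≤ mm P θ (S.erase u))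
    (ew : mm P θ (S.erase w) + 1 = mm P θ S) (v : V) (hv : v ∈ S.erase u) :
    mm P θ ((S.erase u).erase v) + 1 = mm P θ (S.erase u) ↔
      mm P θ (S.erase v) + 1 = mm P θ S := by
  have pu := h.special_pos θ S u w hu hw huw nu ew
  have hvS := Finset.mem_of_mem_erase hv
  have hvu := Finset.ne_of_mem_erase hv
  constructor
  swap
  · exact h.ess_erase θ S u v hu hvS nu
  intro ev
  by_contra nv
  have i1 := h.le_succ θ S v hvS
  have i2 := h.erase_le θ S v hvS
  have hvw : v ≠ w := by rintro rfl; exact nv ew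
  have c1 : (S.erase u).erase v = (S.erase v).erase u := Finset.erase_right_comm
  have mu_v : u ∈ S.erase v := Finset.mem_erase.2 ⟨hvu.symm, hu⟩
  have mw_v : w ∈ S.erase v := Finset.mem_erase.2 ⟨hvw.symm, hw⟩
  have mw_u : w ∈ S.erase u := Finset.mem_erase.2 ⟨huw.ne.symm, hw⟩
  have mu_w : u ∈ S.erase w := Finset.mem_erase.2 ⟨huw.ne, hu⟩
  by_cases hcase : mm P θ (S.erase v) = mm P θ S
  · have ew' := h.ess_erase θ S v w hvS hw (by omega) ew
    have := h.special_pos θ (S.erase v) u w mu_v mw_v huw (by rw [← c1]; omega) ew'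
    rw [← c1] at this
    omega
  · have nbr : ∀ x ∈ S, x ≠ v → G.Adj u x →
        mm P θ S ≤ mm P θ (((S.erase u).erase v).erase x) := by
      intro x hx hxv hux
      have := h.no_nbr_of_not_pos θ (S.erase v) u x mu_v
        (Finset.mem_erase.2 ⟨hux.ne.symm, Finset.mem_erase.2 ⟨hxv, hx⟩⟩) hux
        (by rw [← c1]; omega)
      rw [← c1] at this
      omega
    have k1 := nbr w hw hvw.symm huw
    have ewu := h.ess_erase θ S u w hu hw nu ew
    have c2 : (S.erase w).erase u = (S.erase u).erase w := Finset.erase_right_comm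
    obtain ⟨w', hw', huw', ew'⟩ := h.exists_nbr θ (S.erase w) u mu_w (by rw [c2]; omega)
    rw [c2] at ew' hw'
    have c3 : ((S.erase u).erase v).erase w = ((S.erase u).erase w).erase v :=
      Finset.erase_right_comm
    have hwv' : w' ≠ v := by
      rintro rfl
      rw [c3] at k1
      omega
    simp only [Finset.mem_erase] at hw'
    have k2 := nbr w' hw'.2.2 hwv' huw'
    have mw'_u : w' ∈ S.erase u := Finset.mem_erase.2 ⟨hw'.2.1, hw'.2.2⟩
    have j1 := h.le_succ θ (S.erase u) w' mw'_u
    have j2 := h.le_succ θ ((S.erase u).erase w') w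
      (Finset.mem_erase.2 ⟨Ne.symm hw'.1, mw_u⟩)
    have c4 : ((S.erase u).erase w').erase w = ((S.erase u).erase w).erase w' :=
      Finset.erase_right_comm
    rw [c4] at j2
    have := (h.trans_triple θ _ (S.erase u) rfl).1 w mw_u v hv w' mw'_u (by omega) (by omega)
      (by omega) (by rw [← c3]; omega) (by omega)
    omega

end MRec
namespace MRec

set_option linter.unusedSectionVars false

variable {V : Type*} [DecidableEq V] {G : SimpleGraph V} [DecidableRel G.Adj]
  {P : Finset V → ℝ[X]}

theorem iterate (h : MRec G P) (θ : ℝ) [Fintype V] (D : Set V)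
    (hD : ∀ v, v ∈ D ↔ mm P θ (Finset.univ.erase v) + 1 = mm P θ Finset.univ) (Y : Finset V) :
    (∀ y ∈ Y, y ∈ vertexBoundary G D) →
    mm P θ (Finset.univ \ Y) = mm P θ Finset.univ + Y.card ∧
    ∀ v, v ∉ Y → (mm P θ ((Finset.univ \ Y).erase v) + 1 = mm P θ (Finset.univ \ Y) ↔ v ∈ D) := by
  induction Y using Finset.induction_on with
  | empty =>
    intro _
    simp only [Finset.sdiff_empty]
    exact ⟨by simp, fun v _ => (hD v).symm⟩
  | insert u Y hu ih =>
    intro hY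
    obtain ⟨i1, i2⟩ := ih (fun y hy => hY y (Finset.mem_insert_of_mem hy))
    obtain ⟨huD, w, hwD, huw⟩ := hY u (Finset.mem_insert_self _ _)
    have hwY : w ∉ Y := fun hw => (hY w (Finset.mem_insert_of_mem hw)).1 hwD
    have hu' : u ∈ Finset.univ \ Y := by simp [hu]
    have hw' : w ∈ Finset.univ \ Y := by simp [hwY]
    have ew := (i2 w hwY).2 hwD
    have nu : mm P θ (Finset.univ \ Y) ≤ mm P θ ((Finset.univ \ Y).erase u) := by
      have h1 := (i2 u hu).not.2 huD
      have h2 := h.le_succ θ _ u hu'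
      omega
    have e : Finset.univ \ (insert u Y) = (Finset.univ \ Y).erase u := by
      ext z; simp
    rw [e, Finset.card_insert_of_notMem hu]
    refine ⟨?_, ?_⟩
    · rw [h.special_pos θ _ u w hu' hw' huw nu ew, i1]; ring
    · intro v hv
      simp only [Finset.mem_insert, not_or] at hv
      rw [h.stability θ _ u w hu' hw' huw nu ew v (by simp [hv])]
      exact i2 v hv.2

theorem related (h : MRec G P) (θ : ℝ) (D : Set V) (S : Finset V)
    (hS : ∀ v ∈ D, v ∈ S ∧ mm P θ (S.erase v) + 1 = mm P θ S) (a b : D)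
    (p : (G.induce D).Walk a b) :
    mm P θ S ≤ mm P θ ((S.erase (a : V)).erase (b : V)) + 1 := by
  induction p with
  | nil =>
    rename_i a
    rw [Finset.erase_idem]
    exact (hS a a.2).2.ge
  | cons hadj p ih =>
    rename_i a c b
    have hac : G.Adj a c := hadj
    have h1 := h.no_nbr_of_not_pos θ S a c (hS a a.2).1
      (Finset.mem_erase.2 ⟨hac.ne.symm, (hS c c.2).1⟩) hac (by have := (hS a a.2).2; omega)
    have h2 := (hS a a.2).2
    exact (h.trans_triple θ _ S rfl).1 a (hS a a.2).1 c (hS c c.2).1 b (hS b b.2).1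
      h2 (hS c c.2).2 (hS b b.2).2 (by omega) ih

open Classical in
/-- The vertices of the components in `K`. -/
noncomputable def verts [Fintype V] (G : SimpleGraph V) (D : Set V)
    (K : Set (G.induce D).ConnectedComponent) : Finset V :=
  Finset.univ.filter (fun v => ∃ hv : v ∈ D, (G.induce D).connectedComponentMk ⟨v, hv⟩ ∈ K)

theorem mem_verts [Fintype V] {D : Set V} {K : Set (G.induce D).ConnectedComponent} {v : V} :
    v ∈ verts G D K ↔ ∃ hv : v ∈ D, (G.induce D).connectedComponentMk ⟨v, hv⟩ ∈ K := by
  simp [verts]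

theorem mk_eq_of_adj {D : Set V} {v w : V} (hv : v ∈ D) (hw : w ∈ D) (ha : G.Adj v w) :
    (G.induce D).connectedComponentMk ⟨v, hv⟩ = (G.induce D).connectedComponentMk ⟨w, hw⟩ := by
  apply SimpleGraph.ConnectedComponent.sound
  apply SimpleGraph.Adj.reachable
  exact ha

theorem comp_le_one [Fintype V] (h : MRec G P) (θ : ℝ) (D : Set V) (S : Finset V)
    (hS : ∀ v ∈ D, v ∈ S ∧ mm P θ (S.erase v) + 1 = mm P θ S)
    (hout : ∀ v ∈ S, v ∉ D → ∀ w ∈ D, ¬ G.Adj w v)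
    (c : (G.induce D).ConnectedComponent) : mm P θ (verts G D {c}) ≤ 1 := by
  set C := verts G D {c} with hC
  have memC : ∀ z, z ∈ C ↔ ∃ hv : z ∈ D, (G.induce D).connectedComponentMk ⟨z, hv⟩ = c := by
    intro z; rw [hC, mem_verts]; rfl
  have hCS : C ⊆ S := by
    intro z hz
    obtain ⟨hzD, -⟩ := (memC z).1 hz
    exact (hS z hzD).1
  have hno : ∀ s ∈ C, ∀ t ∈ S \ C, ¬ G.Adj s t := by
    intro s hs t ht hadj
    rw [Finset.mem_sdiff] at ht
    obtain ⟨hsD, hsc⟩ := (memC s).1 hs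
    by_cases htD : t ∈ D
    · exact ht.2 ((memC t).2 ⟨htD, by rw [← mk_eq_of_adj hsD htD hadj]; exact hsc⟩)
    · exact hout t ht.1 htD s hsD hadj
  have addm : ∀ C' ⊆ C, mm P θ (C' ∪ S \ C) = mm P θ C' + mm P θ (S \ C) := by
    intro C' hC'
    exact h.mm_union θ _ _ (Finset.disjoint_sdiff.mono_left hC') (fun s hs => hno s (hC' hs))
  have e0 : S = C ∪ S \ C := by rw [Finset.union_sdiff_of_subset hCS]
  have e1 : ∀ v ∈ C, S.erase v = C.erase v ∪ S \ C := by
    intro v hv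
    conv_lhs => rw [e0]
    rw [Finset.erase_union_distrib, Finset.erase_eq_of_notMem (s := S \ C)]
    simp [hv]
  have e2 : ∀ v ∈ C, ∀ w ∈ C, (S.erase v).erase w = (C.erase v).erase w ∪ S \ C := by
    intro v hv w hw
    rw [e1 v hv, Finset.erase_union_distrib, Finset.erase_eq_of_notMem (s := S \ C)]
    simp [hw]
  have a0 := addm C (Finset.Subset.refl _)
  rw [← e0] at a0
  by_contra hgt
  push Not at hgt
  obtain ⟨v, hv, hev⟩ := h.exists_ess θ C (by omega)
  obtain ⟨w, hw, hew⟩ := h.exists_ess θ (C.erase v) (by omega)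
  have hwC := Finset.mem_of_mem_erase hw
  obtain ⟨hvD, hvc⟩ := (memC v).1 hv
  obtain ⟨hwD, hwc⟩ := (memC w).1 hwC
  obtain ⟨p⟩ := SimpleGraph.ConnectedComponent.exact (hvc.trans hwc.symm)
  have r := h.related θ D S hS _ _ p
  simp only at r
  rw [e2 v hv w hwC, addm _ ((Finset.erase_subset _ _).trans (Finset.erase_subset _ _))] at r
  omega

theorem verts_le [Fintype V] (h : MRec G P) (θ : ℝ) (D : Set V) (S : Finset V)
    (hS : ∀ v ∈ D, v ∈ S ∧ mm P θ (S.erase v) + 1 = mm P θ S)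
    (hout : ∀ v ∈ S, v ∉ D → ∀ w ∈ D, ¬ G.Adj w v)
    (K : Finset (G.induce D).ConnectedComponent) : mm P θ (verts G D (K : Set _)) ≤ K.card := by
  classical
  induction K using Finset.induction_on with
  | empty =>
    have : verts G D ((∅ : Finset (G.induce D).ConnectedComponent) : Set _) = ∅ := by
      ext z; rw [mem_verts]; simp
    rw [this, h.mm_empty]; simp
  | insert c K hc ih =>
    have e : verts G D ((insert c K : Finset _) : Set _) =
        verts G D {c} ∪ verts G D (K : Set _) := by
      ext z
      simp only [Finset.mem_union, mem_verts, Finset.coe_insert, Set.mem_insert_iff,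
        Set.mem_singleton_iff]
      constructor
      · rintro ⟨hz, h1 | h1⟩
        · exact Or.inl ⟨hz, h1⟩
        · exact Or.inr ⟨hz, h1⟩
      · rintro (⟨hz, h1⟩ | ⟨hz, h1⟩)
        · exact ⟨hz, Or.inl h1⟩
        · exact ⟨hz, Or.inr h1⟩
    rw [e, h.mm_union, Finset.card_insert_of_notMem hc]
    · have := h.comp_le_one θ D S hS hout c
      omega
    · rw [Finset.disjoint_left]
      intro z h1 h2
      obtain ⟨hz, h1⟩ := mem_verts.1 h1
      obtain ⟨hz', h2⟩ := mem_verts.1 h2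
      rw [Set.mem_singleton_iff] at h1
      rw [h1] at h2
      exact hc h2
    · intro s hs t ht hadj
      obtain ⟨hz, h1⟩ := mem_verts.1 hs
      obtain ⟨hz', h2⟩ := mem_verts.1 ht
      rw [Set.mem_singleton_iff, mk_eq_of_adj hz hz' hadj] at h1
      rw [h1] at h2
      exact hc h2

theorem count [Fintype V] (h : MRec G P) (θ : ℝ) (D : Set V)
    (hD : ∀ v, v ∈ D ↔ mm P θ (Finset.univ.erase v) + 1 = mm P θ Finset.univ)
    (Y : Set V) (hY : Y.Nonempty) (hYA : Y ⊆ vertexBoundary G D) :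
    Y.ncard + 1 ≤ {c : (G.induce D).ConnectedComponent |
        ∃ w : D, w ∈ c.supp ∧ ∃ x ∈ Y, G.Adj (↑w) x}.ncard := by
  classical
  set K := {c : (G.induce D).ConnectedComponent |
        ∃ w : D, w ∈ c.supp ∧ ∃ x ∈ Y, G.Adj (↑w) x} with hK
  have hKfin : K.Finite := Set.toFinite _
  set A : Finset V := Finset.univ.filter (fun v => v ∈ vertexBoundary G D) with hA
  have memA : ∀ v, v ∈ A ↔ v ∈ vertexBoundary G D := by intro v; simp [hA]
  set Y' : Finset V := Y.toFinset with hY'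
  have memY : ∀ v, v ∈ Y' ↔ v ∈ Y := by intro v; simp [hY']
  obtain ⟨a1, a2⟩ := h.iterate θ D hD A (fun y hy => (memA y).1 hy)
  obtain ⟨b1, b2⟩ := h.iterate θ D hD (A \ Y') (fun y hy => (memA y).1 (Finset.mem_sdiff.1 hy).1)
  set DK := verts G D K with hDK
  set DN := verts G D Kᶜ with hDN
  set R : Finset V := Finset.univ.filter (fun v => v ∉ D ∧ v ∉ A) with hR
  have memR : ∀ v, v ∈ R ↔ v ∉ D ∧ v ∉ A := by intro v; simp [hR]
  have hDA : ∀ v ∈ D, v ∉ A := fun v hv hvA => ((memA v).1 hvA).1 hv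
  have hsplit : ∀ v, v ∈ D → v ∈ DK ∨ v ∈ DN := by
    intro v hv
    by_cases hc : (G.induce D).connectedComponentMk ⟨v, hv⟩ ∈ K
    · exact Or.inl (mem_verts.2 ⟨hv, hc⟩)
    · exact Or.inr (mem_verts.2 ⟨hv, hc⟩)
  have hKD : ∀ v ∈ DK, v ∈ D := fun v hv => (mem_verts.1 hv).1
  have hND : ∀ v ∈ DN, v ∈ D := fun v hv => (mem_verts.1 hv).1
  have hKN : ∀ v ∈ DN, v ∉ DK := by
    intro v hv hv'
    exact (mem_verts.1 hv).2 (mem_verts.1 hv').2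
  have hout : ∀ v, v ∉ D → v ∉ A → ∀ w ∈ D, ¬ G.Adj w v := by
    intro v hv hvA w hw hadj
    exact hvA ((memA v).2 ⟨hv, w, hw, hadj.symm⟩)
  have hYA' : Y' ⊆ A := by
    intro v hv; exact (memA v).2 (hYA ((memY v).1 hv))
  have hnbrK : ∀ d ∈ D, ∀ x ∈ Y, G.Adj d x → d ∈ DK := by
    intro d hd x hx hadj
    exact mem_verts.2 ⟨hd, ⟨d, hd⟩, rfl, x, hx, hadj⟩
  -- no edges
  have nNK : ∀ s ∈ DN, ∀ t ∈ DK, ¬ G.Adj s t := by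
    intro s hs t ht hadj
    obtain ⟨hsD, h1⟩ := mem_verts.1 hs
    obtain ⟨htD, h2⟩ := mem_verts.1 ht
    rw [mk_eq_of_adj hsD htD hadj] at h1
    exact h1 h2
  have nNR : ∀ s ∈ DN, ∀ t ∈ R, ¬ G.Adj s t := fun s hs t ht =>
    hout t ((memR t).1 ht).1 ((memR t).1 ht).2 s (hND s hs)
  have nKR : ∀ s ∈ DK, ∀ t ∈ R, ¬ G.Adj s t := fun s hs t ht =>
    hout t ((memR t).1 ht).1 ((memR t).1 ht).2 s (hKD s hs)
  have nNY : ∀ s ∈ DN, ∀ t ∈ Y', ¬ G.Adj s t := fun s hs t ht hadj =>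
    hKN s hs (hnbrK s (hND s hs) t ((memY t).1 ht) hadj)
  -- R has multiplicity zero
  have hS0 : Finset.univ \ A = (DN ∪ DK) ∪ R := by
    ext z
    simp only [Finset.mem_sdiff, Finset.mem_univ, true_and, Finset.mem_union, memR]
    have := hsplit z; have := hDA z; have := hKD z; have := hND z
    tauto
  have hH : Finset.univ \ (A \ Y') = DN ∪ (DK ∪ R ∪ Y') := by
    ext z
    simp only [Finset.mem_sdiff, Finset.mem_univ, true_and, Finset.mem_union, memR]
    have := hsplit z; have := hDA z; have := hKD z; have := hND z
    have := @hYA' z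
    tauto
  have u1 : ∀ R' ⊆ R, mm P θ ((DN ∪ DK) ∪ R') = mm P θ DN + mm P θ DK + mm P θ R' := by
    intro R' hR'
    rw [h.mm_union, h.mm_union]
    · rw [Finset.disjoint_left]; exact hKN
    · exact nNK
    · rw [Finset.disjoint_left]
      intro z hz hzR
      have := ((memR z).1 (hR' hzR)).1
      have := hKD z; have := hND z
      rw [Finset.mem_union] at hz
      tauto
    · intro s hs t ht
      rcases Finset.mem_union.1 hs with hs | hs
      · exact nNR s hs t (hR' ht)
      · exact nKR s hs t (hR' ht)
  have hR0 : mm P θ R = 0 := by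
    by_contra hne
    obtain ⟨v, hv, hev⟩ := h.exists_ess θ R (Nat.pos_of_ne_zero hne)
    have hvR := (memR v).1 hv
    apply hvR.1
    rw [← a2 v hvR.2, hS0]
    have e : (DN ∪ DK ∪ R).erase v = (DN ∪ DK) ∪ R.erase v := by
      rw [Finset.erase_union_distrib, Finset.erase_eq_of_notMem (s := DN ∪ DK)]
      intro hm
      rcases Finset.mem_union.1 hm with hm | hm
      · exact hvR.1 (hND v hm)
      · exact hvR.1 (hKD v hm)
    rw [e, u1 _ (Finset.erase_subset _ _), u1 _ (Finset.Subset.refl _)]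
    omega
  have u2 : ∀ T ⊆ DK ∪ R ∪ Y', mm P θ (DN ∪ T) = mm P θ DN + mm P θ T := by
    intro T hT
    apply h.mm_union
    · rw [Finset.disjoint_left]
      intro z hz hzT
      have h1 := hT hzT
      simp only [Finset.mem_union, memR] at h1
      have := hKN z hz; have := hND z hz; have := hDA z this
      have := @hYA' z
      tauto
    · intro s hs t ht
      have h1 := hT ht
      simp only [Finset.mem_union] at h1
      rcases h1 with (h1 | h1) | h1
      · exact nNK s hs t h1
      · exact nNR s hs t h1
      · exact nNY s hs t h1
  -- the part with Y has positive multiplicity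
  have hpos : 0 < mm P θ (DK ∪ R ∪ Y') := by
    obtain ⟨x, hx⟩ := hY
    obtain ⟨hxD, d, hdD, hxd⟩ := hYA hx
    have hdK := hnbrK d hdD x hx hxd.symm
    have e := (b2 d (fun hd => hDA d hdD (Finset.mem_sdiff.1 hd).1)).2 hdD
    rw [hH] at e
    have e' : (DN ∪ (DK ∪ R ∪ Y')).erase d = DN ∪ (DK ∪ R ∪ Y').erase d := by
      rw [Finset.erase_union_distrib, Finset.erase_eq_of_notMem (s := DN)]
      exact fun hd => hKN d hd hdK
    rw [e', u2 _ (Finset.erase_subset _ _), u2 _ (Finset.Subset.refl _)] at e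
    omega
  have hle : mm P θ DK ≤ hKfin.toFinset.card := by
    have := h.verts_le θ D (Finset.univ \ A)
      (fun v hv => ⟨by simp [hDA v hv], (a2 v (hDA v hv)).2 hv⟩)
      (fun v hv hvD => hout v hvD (Finset.mem_sdiff.1 hv).2) hKfin.toFinset
    rwa [Set.Finite.coe_toFinset] at this
  rw [Set.ncard_eq_toFinset_card K hKfin, Set.ncard_eq_toFinset_card']
  rw [hS0, u1 _ (Finset.Subset.refl _)] at a1
  rw [hH, u2 _ (Finset.Subset.refl _)] at b1
  have hcard := Finset.card_sdiff_add_card_eq_card hYA'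
  have hcY : Y'.card = Y.toFinset.card := rfl
  omega

end MRec
section graphPart

open Classical in
/-- matchings with all vertices in `S` -/
noncomputable def matchingsIn {V : Type*} [Fintype V] (G : SimpleGraph V) (S : Finset V) :
    Finset (Finset (Sym2 V)) :=
  Finset.univ.filter (fun M =>
    ((∀ e ∈ M, e ∈ G.edgeSet) ∧ ∀ e ∈ M, ∀ f ∈ M, e ≠ f → ∀ v, v ∈ e → v ∉ f) ∧
      ∀ e ∈ M, ∀ v ∈ e, v ∈ S)

theorem mem_matchingsIn {V : Type*} [Fintype V] {G : SimpleGraph V} {S : Finset V}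
    {M : Finset (Sym2 V)} : M ∈ matchingsIn G S ↔
    ((∀ e ∈ M, e ∈ G.edgeSet) ∧ ∀ e ∈ M, ∀ f ∈ M, e ≠ f → ∀ v, v ∈ e → v ∉ f) ∧
      ∀ e ∈ M, ∀ v ∈ e, v ∈ S := by
  simp [matchingsIn]

/-- matching polynomial of an induced subgraph -/
noncomputable def mpoly {V : Type*} [Fintype V] (G : SimpleGraph V) (S : Finset V) : ℝ[X] :=
  ∑ M ∈ matchingsIn G S, (-1 : ℝ[X]) ^ M.card * X ^ (S.card - 2 * M.card)

theorem matchingsIn_card {V : Type*} [Fintype V] {G : SimpleGraph V} {S : Finset V}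
    {M : Finset (Sym2 V)} (hM : M ∈ matchingsIn G S) : 2 * M.card ≤ S.card := by
  classical
  obtain ⟨⟨h1, h2⟩, h3⟩ := mem_matchingsIn.1 hM
  have hd : (M : Set (Sym2 V)).PairwiseDisjoint (fun e => e.toFinset) := by
    intro e he f hf hef
    rw [Function.onFun, Finset.disjoint_left]
    intro v hv hv'
    exact h2 e he f hf hef v (Sym2.mem_toFinset.1 hv) (Sym2.mem_toFinset.1 hv')
  have hc := Finset.card_biUnion hd
  have hs : M.biUnion (fun e => e.toFinset) ⊆ S := by
    intro v hv
    obtain ⟨e, he, hv⟩ := Finset.mem_biUnion.1 hv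
    exact h3 e he v (Sym2.mem_toFinset.1 hv)
  have := Finset.card_le_card hs
  rw [hc, Finset.sum_congr rfl (g := fun _ => 2)] at this
  · simpa [mul_comm] using this
  · intro e he
    exact Sym2.card_toFinset_of_not_isDiag e (G.not_isDiag_of_mem_edgeSet (h1 e he))

theorem mpoly_step {V : Type*} [Fintype V] [DecidableEq V] (G : SimpleGraph V)
    [DecidableRel G.Adj] (S : Finset V) (u : V) (hu : u ∈ S) :
    mpoly G S = X * mpoly G (S.erase u) -
      ∑ y ∈ (S.erase u).filter (fun y => G.Adj u y), mpoly G ((S.erase u).erase y) := by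
  classical
  have hcu := Finset.card_erase_add_one hu
  rw [mpoly, ← Finset.sum_filter_add_sum_filter_not _ (fun M => ∀ e ∈ M, u ∉ e), sub_eq_add_neg]
  congr 1
  · have e : (matchingsIn G S).filter (fun M => ∀ e ∈ M, u ∉ e) = matchingsIn G (S.erase u) := by
      ext M
      rw [Finset.mem_filter, mem_matchingsIn, mem_matchingsIn]
      constructor
      · rintro ⟨⟨h1, h2⟩, h3⟩
        refine ⟨h1, fun e he v hv => Finset.mem_erase.2 ⟨?_, h2 e he v hv⟩⟩
        rintro rfl
        exact h3 e he hv
      · rintro ⟨h1, h2⟩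
        exact ⟨⟨h1, fun e he v hv => Finset.mem_of_mem_erase (h2 e he v hv)⟩,
          fun e he hue => Finset.ne_of_mem_erase (h2 e he u hue) rfl⟩
    rw [e, mpoly, Finset.mul_sum]
    apply Finset.sum_congr rfl
    intro M hM
    have hc := matchingsIn_card hM
    have : S.card - 2 * M.card = ((S.erase u).card - 2 * M.card) + 1 := by omega
    rw [this, pow_succ]
    ring
  · have e : (matchingsIn G S).filter (fun M => ¬ ∀ e ∈ M, u ∉ e) =
        ((S.erase u).filter (fun y => G.Adj u y)).biUnion
          (fun y => (matchingsIn G S).filter (fun M => s(u, y) ∈ M)) := by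
      ext M
      simp only [Finset.mem_filter, Finset.mem_biUnion]
      constructor
      · rintro ⟨hM, h⟩
        push Not at h
        obtain ⟨e, he, hue⟩ := h
        obtain ⟨y, rfl⟩ := hue
        obtain ⟨⟨h1, h2⟩, h3⟩ := mem_matchingsIn.1 hM
        have hadj : G.Adj u y := h1 _ he
        exact ⟨y, ⟨Finset.mem_erase.2 ⟨hadj.ne.symm, h3 _ he y (by simp)⟩, hadj⟩, hM, he⟩
      · rintro ⟨y, _, hM, he⟩
        exact ⟨hM, fun h => h _ he (by simp)⟩
    rw [e, Finset.sum_biUnion, ← Finset.sum_neg_distrib]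
    · apply Finset.sum_congr rfl
      intro y hy
      obtain ⟨hyS, hadj⟩ := Finset.mem_filter.1 hy
      have hcy := Finset.card_erase_add_one hyS
      rw [mpoly, ← Finset.sum_neg_distrib]
      have hnot : ∀ M ∈ matchingsIn G ((S.erase u).erase y), s(u, y) ∉ M := by
        intro M hM hm
        have := (mem_matchingsIn.1 hM).2 _ hm y (by simp)
        simp at this
      refine Finset.sum_bij' (fun M _ => M.erase s(u, y)) (fun M _ => insert s(u, y) M)
        ?_ ?_ ?_ ?_ ?_
      · intro M hM
        obtain ⟨hM, hm⟩ := Finset.mem_filter.1 hM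
        obtain ⟨⟨h1, h2⟩, h3⟩ := mem_matchingsIn.1 hM
        refine mem_matchingsIn.2 ⟨⟨fun e he => h1 e (Finset.mem_of_mem_erase he),
          fun e he f hf => h2 e (Finset.mem_of_mem_erase he) f (Finset.mem_of_mem_erase hf)⟩, ?_⟩
        intro e he v hv
        have hne := Finset.ne_of_mem_erase he
        have he' := Finset.mem_of_mem_erase he
        have := h2 e he' _ hm hne v hv
        simp only [Sym2.mem_iff, not_or] at this
        exact Finset.mem_erase.2 ⟨this.2, Finset.mem_erase.2 ⟨this.1, h3 e he' v hv⟩⟩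
      · intro M hM
        obtain ⟨⟨h1, h2⟩, h3⟩ := mem_matchingsIn.1 hM
        have hout : ∀ e ∈ M, ∀ v ∈ e, v ∉ s(u, y) := by
          intro e he v hv hv'
          have := h3 e he v hv
          simp only [Finset.mem_erase] at this
          simp only [Sym2.mem_iff] at hv'
          tauto
        refine Finset.mem_filter.2 ⟨mem_matchingsIn.2 ⟨⟨?_, ?_⟩, ?_⟩, Finset.mem_insert_self _ _⟩
        · intro e he
          rcases Finset.mem_insert.1 he with rfl | he
          · exact hadj
          · exact h1 e he
        · intro e he f hf hef v hv hv'
          rcases Finset.mem_insert.1 he with rfl | he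
          · rcases Finset.mem_insert.1 hf with rfl | hf
            · exact hef rfl
            · exact hout f hf v hv' hv
          · rcases Finset.mem_insert.1 hf with rfl | hf
            · exact hout e he v hv hv'
            · exact h2 e he f hf hef v hv hv'
        · intro e he v hv
          rcases Finset.mem_insert.1 he with rfl | he
          · rcases Sym2.mem_iff.1 hv with rfl | rfl
            · exact hu
            · exact Finset.mem_of_mem_erase hyS
          · exact Finset.mem_of_mem_erase (Finset.mem_of_mem_erase (h3 e he v hv))
      · intro M hM
        exact Finset.insert_erase (Finset.mem_filter.1 hM).2
      · intro M hM
        exact Finset.erase_insert (hnot M hM)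
      · intro M hM
        have hm := Finset.card_erase_add_one (Finset.mem_filter.1 hM).2
        have : S.card - 2 * M.card =
          ((S.erase u).erase y).card - 2 * (M.erase s(u, y)).card := by omega
        rw [this, ← hm, pow_succ]
        ring
    · intro y hy z hz hyz
      rw [Function.onFun, Finset.disjoint_left]
      intro M hM hM'
      obtain ⟨hM, hm⟩ := Finset.mem_filter.1 hM
      obtain ⟨-, hm'⟩ := Finset.mem_filter.1 hM'
      obtain ⟨⟨h1, h2⟩, h3⟩ := mem_matchingsIn.1 hM
      refine h2 _ hm _ hm' ?_ u (by simp) (by simp)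
      intro h
      exact hyz (Sym2.congr_right.1 h)

theorem mpoly_rec {V : Type*} [Fintype V] [DecidableEq V] (G : SimpleGraph V)
    [DecidableRel G.Adj] : MRec G (mpoly G) where
  emp := by
    have : matchingsIn G ∅ = {∅} := by
      ext M
      rw [Finset.mem_singleton]
      constructor
      · intro hM
        have := matchingsIn_card hM
        rw [Finset.card_empty] at this
        exact Finset.card_eq_zero.1 (by omega)
      · rintro rfl
        simp [mem_matchingsIn]
    simp [mpoly, this]
  step := mpoly_step G

theorem matchingPolynomial_univ_aux {V : Type*} [Finite V] (inst : Fintype V)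
    (hi : inst = Fintype.ofFinite V) (G : SimpleGraph V) :
    matchingPolynomial G = mpoly G Finset.univ := by
  classical
  unfold matchingPolynomial mpoly
  refine Finset.sum_congr ?_ ?_
  · ext M
    refine Iff.trans (@Finset.mem_filter _ _ (_) _ _) ?_
    refine Iff.trans ?_ (mem_matchingsIn).symm
    constructor
    · rintro ⟨-, h⟩
      exact ⟨h, fun _ _ v _ => Finset.mem_univ v⟩
    · rintro ⟨h, -⟩
      refine ⟨?_, h⟩
      exact @Finset.mem_univ _ (_) M
  · intro M _
    rw [Nat.card_eq_fintype_card, Finset.card_univ]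

theorem matchingPolynomial_univ {V : Type*} [inst : Fintype V] (G : SimpleGraph V) :
    matchingPolynomial G = mpoly G Finset.univ :=
  matchingPolynomial_univ_aux inst (Subsingleton.elim _ _) G

theorem matchingPolynomial_induce {V : Type*} [Fintype V] (G : SimpleGraph V) (T : Set V)
    (S : Finset V) (hS : ∀ v, v ∈ S ↔ v ∈ T) :
    matchingPolynomial (G.induce T) = mpoly G S := by
  classical
  have : Fintype T := Fintype.ofFinite T
  rw [matchingPolynomial_univ]
  unfold mpoly
  have hcard : Nat.card T = S.card := by
    rw [Nat.card_eq_card_toFinset]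
    congr 1
    ext v
    simp [hS]
  have hinj : Function.Injective (Sym2.map (Subtype.val : T → V)) :=
    Sym2.map.injective Subtype.val_injective
  refine Finset.sum_bij (fun M _ => M.image (Sym2.map (Subtype.val : T → V))) ?_ ?_ ?_ ?_
  · intro M hM
    obtain ⟨⟨h1, h2⟩, -⟩ := mem_matchingsIn.1 hM
    refine mem_matchingsIn.2 ⟨⟨?_, ?_⟩, ?_⟩
    · intro e he
      obtain ⟨e, he1, rfl⟩ := Finset.mem_image.1 he
      have := h1 e he1
      induction e with
      | _ a b => exact this
    · intro e he f hf hef v hv hv'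
      obtain ⟨e, he1, rfl⟩ := Finset.mem_image.1 he
      obtain ⟨f, hf1, rfl⟩ := Finset.mem_image.1 hf
      obtain ⟨a, ha, rfl⟩ := Sym2.mem_map.1 hv
      obtain ⟨b, hb, hab⟩ := Sym2.mem_map.1 hv'
      have := Subtype.val_injective hab
      subst this
      exact h2 e he1 f hf1 (fun h => hef (by rw [h])) b ha hb
    · intro e he v hv
      obtain ⟨e, he1, rfl⟩ := Finset.mem_image.1 he
      obtain ⟨a, ha, rfl⟩ := Sym2.mem_map.1 hv
      exact (hS _).2 a.2
  · intro M _ N _ h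
    exact Finset.image_injective hinj h
  · intro M hM
    obtain ⟨⟨h1, h2⟩, h3⟩ := mem_matchingsIn.1 hM
    refine ⟨Finset.univ.filter (fun e => Sym2.map (Subtype.val : T → V) e ∈ M), ?_, ?_⟩
    · refine mem_matchingsIn.2 ⟨⟨?_, ?_⟩, by simp⟩
      · intro e he
        have := h1 _ (Finset.mem_filter.1 he).2
        induction e with
        | _ a b => exact this
      · intro e he f hf hef v hv hv'
        exact h2 _ (Finset.mem_filter.1 he).2 _ (Finset.mem_filter.1 hf).2 (hinj.ne hef) v
          (Sym2.mem_map.2 ⟨v, hv, rfl⟩) (Sym2.mem_map.2 ⟨v, hv', rfl⟩)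
    · ext e
      simp only [Finset.mem_image, Finset.mem_filter]
      constructor
      · rintro ⟨a, ⟨-, ha⟩, rfl⟩
        exact ha
      · intro he
        have h4 := h3 e he
        induction e with
        | _ a b =>
          exact ⟨s(⟨a, (hS a).1 (h4 a (by simp))⟩, ⟨b, (hS b).1 (h4 b (by simp))⟩),
            ⟨Finset.mem_univ _, he⟩, rfl⟩
  · intro M hM
    rw [Finset.card_image_of_injective _ hinj, Finset.card_univ, ← Nat.card_eq_fintype_card, hcard]

end graphPart
-- statement 3
theorem gallai_edmonds_component_count {V : Type*} [Finite V] (θ : ℝ) (G : SimpleGraph V)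
    (X : Set V) (hX : X.Nonempty)
    (hXA : X ⊆ vertexBoundary G {v | IsEssential θ G v}) :
    X.ncard + 1 ≤
      {c : (G.induce {v | IsEssential θ G v}).ConnectedComponent |
        ∃ w : ↥{v | IsEssential θ G v}, w ∈ c.supp ∧ ∃ x ∈ X, G.Adj (↑w) x}.ncard := by
  classical
  have : Fintype V := Fintype.ofFinite V
  refine (mpoly_rec G).count θ {v | IsEssential θ G v} ?_ X hX hXA
  intro v
  change IsEssential θ G v ↔ _
  rw [IsEssential, matchMult, matchMult,
    matchingPolynomial_induce G {w | w ≠ v} (Finset.univ.erase v) (by simp),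
    matchingPolynomial_univ]
  rfl
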